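/- arXiv:1201.5958 — 3 statements merged into one kernel-verified Lean document; each statement's English description precedes it below -/
import Mathlib

section
/- Let G be a finite simple graph on vertex set V with edge set E, let A ⊆ V, and let G₁ be the graph on V with edge set E ∪ {xy : x, y ∈ A, x ≠ y}. Then box(G₁) ≤ 2 · box(G). -/
/-- A finite simple graph `H` is an interval graph if there is an assignment of
real intervals `[l v, r v]` (with `l v ≤ r v`) to the vertices such that distinct
vertices are adjacent iff their intervals intersect. -/
def IsIntervalGraph {V : Type*} (H : SimpleGraph V) : Prop :=
  ∃ l r : V → ℝ, (∀ v, l v ≤ r v) ∧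
    ∀ u v : V, u ≠ v →
      (H.Adj u v ↔ (Set.Icc (l u) (r u) ∩ Set.Icc (l v) (r v)).Nonempty)

/-- The boxicity of `G` : the least `k` such that `G` is the edge-intersection of
`k` interval graphs on the same vertex set. -/
noncomputable def boxicity {V : Type*} (G : SimpleGraph V) : ℕ :=
  sInf {k | ∃ I : Fin k → SimpleGraph V,
    (∀ i, IsIntervalGraph (I i)) ∧ ∀ u v : V, G.Adj u v ↔ ∀ i, (I i).Adj u v}

theorem isIntervalGraph_iff {V : Type*} {H : SimpleGraph V} :
    IsIntervalGraph H ↔ ∃ l r : V → ℝ, (∀ v, l v ≤ r v) ∧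
      ∀ u v : V, H.Adj u v ↔ u ≠ v ∧ l u ≤ r v ∧ l v ≤ r u := by
  unfold IsIntervalGraph
  refine exists_congr fun l => exists_congr fun r => and_congr_right fun hlr =>
    forall_congr' fun u => forall_congr' fun v => ?_
  have hmeet : (Set.Icc (l u) (r u) ∩ Set.Icc (l v) (r v)).Nonempty ↔
      l u ≤ r v ∧ l v ≤ r u := by
    rw [Set.Icc_inter_Icc, Set.nonempty_Icc, sup_le_iff, le_inf_iff, le_inf_iff]
    simp [hlr u, hlr v]
  rw [hmeet]
  refine ⟨fun h => ⟨fun huv => ⟨huv.ne, (h huv.ne).1 huv⟩, fun huv => (h huv.1).2 huv.2⟩,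
    fun h hne => by simp [h, hne]⟩

/-- The intersection graph of the intervals `[l v, r v]`. -/
def intervalGraph {V : Type*} (l r : V → ℝ) : SimpleGraph V where
  Adj u v := u ≠ v ∧ l u ≤ r v ∧ l v ≤ r u
  symm := ⟨fun _ _ h => ⟨h.1.symm, h.2.2, h.2.1⟩⟩
  loopless := ⟨fun _ h => h.1 rfl⟩

theorem isIntervalGraph_intervalGraph {V : Type*} {l r : V → ℝ} (h : ∀ v, l v ≤ r v) :
    IsIntervalGraph (intervalGraph l r) :=
  isIntervalGraph_iff.2 ⟨l, r, h, fun _ _ => Iff.rfl⟩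

/-- Every finite graph is an intersection of interval graphs, one for each vertex `a`: the graph
in which `a` keeps its neighbours and all other vertices are pairwise adjacent. -/
theorem exists_isIntervalGraph_family {V : Type*} [Fintype V] (G : SimpleGraph V) :
    ∃ k, ∃ I : Fin k → SimpleGraph V,
      (∀ i, IsIntervalGraph (I i)) ∧ ∀ u v : V, G.Adj u v ↔ ∀ i, (I i).Adj u v := by
  classical
  let l : V → V → ℝ := fun a v => if v = a ∨ G.Adj a v then 0 else 1
  let r : V → V → ℝ := fun a v => if v = a then 0 else 1
  refine ⟨Fintype.card V, fun i => intervalGraph (l ((Fintype.equivFin V).symm i))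
    (r ((Fintype.equivFin V).symm i)), fun i => isIntervalGraph_intervalGraph fun v => ?_,
    fun u v => ?_⟩
  · simp only [l, r]
    split_ifs <;> simp_all
  · rw [(Fintype.equivFin V).symm.forall_congr_left]
    simp only [Equiv.symm_symm, Equiv.symm_apply_apply]
    constructor
    · intro huv a
      refine ⟨huv.ne, ?_, ?_⟩ <;> simp only [l, r] <;> split_ifs <;>
        simp_all [SimpleGraph.adj_comm]
    · intro hall
      obtain ⟨hne, -, hle⟩ := hall u
      by_contra hnot
      simp only [l, r, hne.symm, hnot, or_self, if_true, if_false] at hle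
      linarith

/-- Making a vertex set `A` a clique in an interval graph gives an intersection of two interval
graphs: extend the intervals of `A` far to the left in one and far to the right in the other. -/
theorem IsIntervalGraph.exists_add_clique {V : Type*} [Finite V] {H : SimpleGraph V}
    (hH : IsIntervalGraph H) (A : Set V) :
    ∃ J : Fin 2 → SimpleGraph V, (∀ j, IsIntervalGraph (J j)) ∧
      ∀ u v : V, (H.Adj u v ∨ (u ∈ A ∧ v ∈ A ∧ u ≠ v)) ↔ ∀ j, (J j).Adj u v := by
  classical
  obtain ⟨l, r, hlr, hadj⟩ := isIntervalGraph_iff.1 hH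
  obtain ⟨m, hm⟩ := (Set.finite_range l).bddBelow
  obtain ⟨M, hM⟩ := (Set.finite_range r).bddAbove
  have hm' : ∀ v, m ≤ l v := fun v => hm ⟨v, rfl⟩
  have hM' : ∀ v, r v ≤ M := fun v => hM ⟨v, rfl⟩
  refine ⟨![intervalGraph (fun v => if v ∈ A then m else l v) r,
    intervalGraph l (fun v => if v ∈ A then M else r v)], ?_, fun u v => ?_⟩
  · rw [Fin.forall_fin_two]
    refine ⟨isIntervalGraph_intervalGraph fun v => ?_, isIntervalGraph_intervalGraph fun v => ?_⟩
    all_goals grind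
  · rw [Fin.forall_fin_two, hadj]
    simp only [Matrix.cons_val_zero, Matrix.cons_val_one, intervalGraph]
    grind

/-- If `G₁` is obtained from `G` by adding all edges between (distinct) pairs of
vertices of `A`, then `box(G₁) ≤ 2 · box(G)`. -/
theorem boxicity_addCliqueEdges_le_two_mul
    {V : Type*} [Fintype V] (G G₁ : SimpleGraph V) (A : Set V)
    (h : ∀ u v : V, G₁.Adj u v ↔ G.Adj u v ∨ (u ∈ A ∧ v ∈ A ∧ u ≠ v)) :
    boxicity G₁ ≤ 2 * boxicity G := by
  obtain ⟨I, hI, hG⟩ := Nat.sInf_mem (exists_isIntervalGraph_family G)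
  choose J hJ hIJ using fun i => (hI i).exists_add_clique A
  refine Nat.sInf_le ⟨fun t => J (finProdFinEquiv.symm t).2 (finProdFinEquiv.symm t).1,
    fun t => hJ _ _, fun u v => ?_⟩
  rw [finProdFinEquiv.symm.forall_congr_left, h, hG, ← forall_or_right]
  simp only [hIJ, Prod.forall, Equiv.symm_symm, Equiv.symm_apply_apply]
  exact forall_comm
end

section
/- Let G be a finite simple graph on vertex set V and let A ⊆ V be such that V ∖ A induces a clique in G. If G has a box representation of dimension b (that is, interval graphs I₁, …, I_b on V with E(G) = E(I₁) ∩ ⋯ ∩ E(I_b)), then G has a box representation {I′₁, …, I′_b} of the same dimension b in which every I′ᵢ is a nice interval supergraph of G with respect to the clique V ∖ A. -/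
/-- `H` is a nice interval supergraph of `G` with respect to a clique `S` of `G` if
`H` is an interval supergraph of `G` having an interval representation `v ↦ [l v, r v]`
and a point `p` such that `p` lies in the interval of every `v ∈ S`, and for every
`v ∈ S`, `l v = min ({p} ∪ {r u : u ∈ N_G(v) \ S})` and
`r v = max ({p} ∪ {l u : u ∈ N_G(v) \ S})`. -/
def IsNiceIntervalSupergraph {V : Type*} (G : SimpleGraph V) (S : Set V)
    (H : SimpleGraph V) : Prop :=
  G ≤ H ∧ ∃ l r : V → ℝ, (∀ v, l v ≤ r v) ∧
    (∀ u v : V, u ≠ v →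
      (H.Adj u v ↔ (Set.Icc (l u) (r u) ∩ Set.Icc (l v) (r v)).Nonempty)) ∧
    ∃ p : ℝ,
      (∀ v ∈ S, p ∈ Set.Icc (l v) (r v)) ∧
      ∀ v ∈ S,
        IsLeast ({p} ∪ (r '' (G.neighborSet v \ S))) (l v) ∧
        IsGreatest ({p} ∪ (l '' (G.neighborSet v \ S))) (r v)

/-- A finite family of closed real intervals with pairwise `l u ≤ r v` has a common point. -/
theorem exists_mem_Icc_of_forall_le {V : Type*} [Finite V] (S : Set V) (l r : V → ℝ)
    (h : ∀ u ∈ S, ∀ v ∈ S, l u ≤ r v) :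
    ∃ p : ℝ, ∀ v ∈ S, p ∈ Set.Icc (l v) (r v) := by
  rcases S.eq_empty_or_nonempty with rfl | hS
  · exact ⟨0, by simp⟩
  · obtain ⟨w, hw, hmax⟩ := Set.exists_max_image S l S.toFinite hS
    exact ⟨l w, fun v hv => ⟨hmax v hv, h w hw v hv⟩⟩

/-- Two closed real intervals meet iff each starts before the other ends. -/
theorem Icc_inter_Icc_nonempty_iff {a b c d : ℝ} (hab : a ≤ b) (hcd : c ≤ d) :
    (Set.Icc a b ∩ Set.Icc c d).Nonempty ↔ a ≤ d ∧ c ≤ b := by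
  rw [Set.Icc_inter_Icc, Set.nonempty_Icc]
  simp [hab, hcd, and_comm]

/-- Every interval supergraph of `G` contains a nice interval supergraph of `G` with
respect to a given clique. -/
theorem IsIntervalGraph.exists_isNiceIntervalSupergraph_le {V : Type*} [Finite V]
    {G H : SimpleGraph V} {S : Set V} (hS : G.IsClique S) (hGH : G ≤ H)
    (hH : IsIntervalGraph H) :
    ∃ H' ≤ H, IsNiceIntervalSupergraph G S H' := by
  classical
  obtain ⟨l, r, hlr, hadj⟩ := hH
  have hle : ∀ u v, G.Adj u v → l u ≤ r v := fun u v huv =>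
    ((Icc_inter_Icc_nonempty_iff (hlr u) (hlr v)).1 ((hadj u v huv.ne).1 (hGH huv))).1
  obtain ⟨p, hp⟩ := exists_mem_Icc_of_forall_le S l r fun u hu v hv => by
    rcases eq_or_ne u v with rfl | huv
    · exact hlr u
    · exact hle u v (hS hu hv huv)
  have hleast : ∀ v, ∃ a, IsLeast ({p} ∪ r '' (G.neighborSet v \ S)) a := fun v =>
    let ⟨a, ha, hmin⟩ := Set.exists_min_image ({p} ∪ r '' (G.neighborSet v \ S)) id
      (Set.toFinite _) ⟨p, Or.inl rfl⟩
    ⟨a, ha, hmin⟩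
  have hgreatest : ∀ v, ∃ a, IsGreatest ({p} ∪ l '' (G.neighborSet v \ S)) a := fun v =>
    let ⟨a, ha, hmax⟩ := Set.exists_max_image ({p} ∪ l '' (G.neighborSet v \ S)) id
      (Set.toFinite _) ⟨p, Or.inl rfl⟩
    ⟨a, ha, hmax⟩
  choose m hm using hleast
  choose M hM using hgreatest
  have hmp : ∀ v, m v ≤ p := fun v => (hm v).2 (Or.inl rfl)
  have hpM : ∀ v, p ≤ M v := fun v => (hM v).2 (Or.inl rfl)
  have hmr : ∀ v u, u ∉ S → G.Adj v u → m v ≤ r u := fun v u hu huv =>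
    (hm v).2 (Or.inr ⟨u, ⟨huv, hu⟩, rfl⟩)
  have hlM : ∀ v u, u ∉ S → G.Adj v u → l u ≤ M v := fun v u hu huv =>
    (hM v).2 (Or.inr ⟨u, ⟨huv, hu⟩, rfl⟩)
  have hlm : ∀ v ∈ S, l v ≤ m v := by
    intro v hv
    rcases (hm v).1 with h | ⟨u, hu, h⟩
    · exact (hp v hv).1.trans_eq h.symm
    · exact (hle v u hu.1).trans_eq h
  have hMr : ∀ v ∈ S, M v ≤ r v := by
    intro v hv
    rcases (hM v).1 with h | ⟨u, hu, h⟩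
    · exact h.trans_le (hp v hv).2
    · exact h.symm.trans_le (hle u v hu.1.symm)
  let l' : V → ℝ := S.piecewise m l
  let r' : V → ℝ := S.piecewise M r
  have hl'S : ∀ v ∈ S, l' v = m v := fun v hv => Set.piecewise_eq_of_mem _ _ _ hv
  have hr'S : ∀ v ∈ S, r' v = M v := fun v hv => Set.piecewise_eq_of_mem _ _ _ hv
  have hl'A : ∀ v ∉ S, l' v = l v := fun v hv => Set.piecewise_eq_of_notMem _ _ _ hv
  have hr'A : ∀ v ∉ S, r' v = r v := fun v hv => Set.piecewise_eq_of_notMem _ _ _ hv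
  have hl' : ∀ v, l v ≤ l' v := fun v => by
    by_cases hv : v ∈ S
    · exact (hlm v hv).trans_eq (hl'S v hv).symm
    · exact (hl'A v hv).ge
  have hr' : ∀ v, r' v ≤ r v := fun v => by
    by_cases hv : v ∈ S
    · exact (hr'S v hv).trans_le (hMr v hv)
    · exact (hr'A v hv).le
  have hlr' : ∀ v, l' v ≤ r' v := fun v => by
    by_cases hv : v ∈ S
    · rw [hl'S v hv, hr'S v hv]
      exact (hmp v).trans (hpM v)
    · rw [hl'A v hv, hr'A v hv]
      exact hlr v
  have hle' : ∀ u v, G.Adj u v → l' u ≤ r' v := by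
    intro u v huv
    by_cases hu : u ∈ S <;> by_cases hv : v ∈ S
    · rw [hl'S u hu, hr'S v hv]
      exact (hmp u).trans (hpM v)
    · rw [hl'S u hu, hr'A v hv]
      exact hmr u v hv huv
    · rw [hl'A u hu, hr'S v hv]
      exact hlM v u hu huv.symm
    · rw [hl'A u hu, hr'A v hv]
      exact hle u v huv
  let H' : SimpleGraph V :=
    { Adj := fun u v => u ≠ v ∧ (Set.Icc (l' u) (r' u) ∩ Set.Icc (l' v) (r' v)).Nonempty
      symm := ⟨fun u v h => ⟨h.1.symm, Set.inter_comm _ _ ▸ h.2⟩⟩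
      loopless := ⟨fun u h => h.1 rfl⟩ }
  refine ⟨H', fun u v huv => (hadj u v huv.1).2 (huv.2.mono ?_), fun u v huv => ⟨huv.ne, ?_⟩,
    l', r', hlr', fun u v huv => ⟨fun h => h.2, fun h => ⟨huv, h⟩⟩, p, fun v hv => ?_,
    fun v hv => ⟨?_, ?_⟩⟩
  · exact Set.inter_subset_inter (Set.Icc_subset_Icc (hl' u) (hr' u))
      (Set.Icc_subset_Icc (hl' v) (hr' v))
  · exact (Icc_inter_Icc_nonempty_iff (hlr' u) (hlr' v)).2 ⟨hle' u v huv, hle' v u huv.symm⟩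
  · rw [hl'S v hv, hr'S v hv]
    exact ⟨hmp v, hpM v⟩
  · rw [hl'S v hv, Set.image_congr fun u hu => hr'A u hu.2]
    exact hm v
  · rw [hr'S v hv, Set.image_congr fun u hu => hl'A u hu.2]
    exact hM v

/-- If `V \ A` induces a clique in `G` and `G` has a box representation of dimension
`b`, then `G` has a box representation of dimension `b` consisting of nice interval
supergraphs of `G` with respect to the clique `V \ A`. -/
theorem exists_nice_box_representation
    {V : Type*} [Fintype V] (G : SimpleGraph V) (A : Set V)
    (hclique : G.IsClique Aᶜ) (b : ℕ) (I : Fin b → SimpleGraph V)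
    (hI : ∀ i, IsIntervalGraph (I i))
    (hrep : ∀ u v : V, G.Adj u v ↔ ∀ i, (I i).Adj u v) :
    ∃ I' : Fin b → SimpleGraph V,
      (∀ i, IsNiceIntervalSupergraph G Aᶜ (I' i)) ∧
      ∀ u v : V, G.Adj u v ↔ ∀ i, (I' i).Adj u v := by
  have hG : ∀ i, G ≤ I i := fun i u v huv => (hrep u v).1 huv i
  choose I' hle hnice using fun i =>
    (hI i).exists_isNiceIntervalSupergraph_le hclique (hG i)
  exact ⟨I', hnice, fun u v => ⟨fun h i => (hnice i).1 h,
    fun h => (hrep u v).2 fun i => hle i (h i)⟩⟩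
end

section
/- Let G be a finite simple graph on vertex set V and let S ⊆ V be a vertex cover of G (every edge of G has at least one endpoint in S), with V ∖ S nonempty. For each A ⊆ S let N_A = {v ∈ V ∖ S : N_G(v) = A}, and let t = max{|N_A| : A ⊆ S, N_A ≠ ∅}. Then there exist q = ⌈log₂ t⌉ unit interval graphs J₁, …, J_q on V, each a supergraph of G (E(G) ⊆ E(Jᵢ) for all i), such that for any two distinct vertices u, v ∈ V ∖ S with N_G(u) = N_G(v), there is some i with 1 ≤ i ≤ q for which u and v are not adjacent in Jᵢ. -/
/-- A finite simple graph `H` is a unit interval graph if there is an assignment of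
real unit intervals `[l v, l v + 1]` to the vertices such that distinct vertices are
adjacent iff their intervals intersect. -/
def IsUnitIntervalGraph {V : Type*} (H : SimpleGraph V) : Prop :=
  ∃ l : V → ℝ,
    ∀ u v : V, u ≠ v →
      (H.Adj u v ↔ (Set.Icc (l u) (l u + 1) ∩ Set.Icc (l v) (l v + 1)).Nonempty)

/-- The cubicity of `G` : the least `k` such that `G` is the edge-intersection of
`k` unit interval graphs on the same vertex set. -/
noncomputable def cubicity {V : Type*} (G : SimpleGraph V) : ℕ :=
  sInf {k | ∃ I : Fin k → SimpleGraph V,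
    (∀ i, IsUnitIntervalGraph (I i)) ∧ ∀ u v : V, G.Adj u v ↔ ∀ i, (I i).Adj u v}

/-- The unit interval graph of `l : V → ℝ`: distinct vertices are adjacent iff their images
under `l` are at distance at most `1`. -/
def unitIntervalGraph {V : Type*} (l : V → ℝ) : SimpleGraph V where
  Adj u v := u ≠ v ∧ |l u - l v| ≤ 1
  symm := ⟨fun _ _ h => ⟨h.1.symm, abs_sub_comm (l _) (l _) ▸ h.2⟩⟩
  loopless := ⟨fun _ h => h.1 rfl⟩

theorem isUnitIntervalGraph_unitIntervalGraph {V : Type*} (l : V → ℝ) :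
    IsUnitIntervalGraph (unitIntervalGraph l) := by
  refine ⟨l, fun u v huv => ?_⟩
  rw [Set.Icc_inter_Icc, Set.nonempty_Icc]
  simp only [unitIntervalGraph, ne_eq, huv, not_false_eq_true, true_and, abs_le,
    sup_le_iff, le_inf_iff]
  constructor
  · rintro ⟨h₁, h₂⟩
    refine ⟨⟨?_, ?_⟩, ?_, ?_⟩ <;> linarith
  · rintro ⟨⟨_, h₁⟩, h₂, _⟩
    constructor <;> linarith

theorem Set.exists_injOn_lt_ncard {α : Type*} [Finite α] (s : Set α) :
    ∃ f : α → ℕ, s.InjOn f ∧ ∀ x ∈ s, f x < s.ncard := by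
  classical
  refine ⟨fun x => if h : x ∈ s then Finite.equivFin s ⟨x, h⟩ else 0, fun x hx y hy h => ?_,
    fun x hx => ?_⟩
  · simp only [hx, hy, dif_pos, Fin.val_inj] at h
    exact congrArg Subtype.val ((Finite.equivFin s).injective h)
  · simp only [hx, dif_pos]
    exact (Finite.equivFin s ⟨x, hx⟩).isLt

theorem Nat.exists_testBit_ne_of_lt_two_pow {m n q : ℕ} (hm : m < 2 ^ q) (hn : n < 2 ^ q)
    (h : m ≠ n) : ∃ i < q, m.testBit i ≠ n.testBit i := by
  contrapose! h
  refine Nat.eq_of_testBit_eq fun i => ?_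
  rcases lt_or_ge i q with hi | hi
  · exact h i hi
  · have hq : 2 ^ q ≤ 2 ^ i := Nat.pow_le_pow_right two_pos hi
    rw [Nat.testBit_lt_two_pow (hm.trans_le hq), Nat.testBit_lt_two_pow (hn.trans_le hq)]

/-- Let `S` be a vertex cover of `G` with `V \ S` nonempty, for `A ⊆ S` let
`N_A = {v ∈ V \ S : N_G(v) = A}`, and let `t = max {|N_A| : A ⊆ S, N_A ≠ ∅}`. Then
there exist `q = ⌈log₂ t⌉` unit interval supergraphs `J₁, …, J_q` of `G` such that
any two distinct vertices of `V \ S` with equal neighborhoods in `G` are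
non-adjacent in some `Jᵢ`. -/
theorem exists_unitInterval_supergraphs_separating_twins
    {V : Type*} [Fintype V] (G : SimpleGraph V) (S : Set V)
    (hcover : ∀ u v : V, G.Adj u v → u ∈ S ∨ v ∈ S)
    (hne : (Sᶜ : Set V).Nonempty)
    (t : ℕ)
    (ht : IsGreatest {m : ℕ | ∃ A : Set V, A ⊆ S ∧
      {v : V | v ∉ S ∧ G.neighborSet v = A}.Nonempty ∧
      m = {v : V | v ∉ S ∧ G.neighborSet v = A}.ncard} t) :
    ∃ J : Fin (Nat.clog 2 t) → SimpleGraph V,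
      (∀ i, IsUnitIntervalGraph (J i) ∧ G ≤ J i) ∧
      ∀ u v : V, u ≠ v → u ∉ S → v ∉ S →
        G.neighborSet u = G.neighborSet v → ∃ i, ¬ (J i).Adj u v := by
  classical
  let C : Set V → Set V := fun A => {v | v ∉ S ∧ G.neighborSet v = A}
  choose f hf hlt using fun A => Set.exists_injOn_lt_ncard (C A)
  let c : V → ℕ := fun v => f (G.neighborSet v) v
  have hc : ∀ v, v ∉ S → c v < 2 ^ Nat.clog 2 t := fun v hv =>
    calc c v < (C (G.neighborSet v)).ncard := hlt _ v ⟨hv, rfl⟩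
      _ ≤ t := ht.2 ⟨_, fun w hw => (hcover v w hw).resolve_left hv, ⟨v, hv, rfl⟩, rfl⟩
      _ ≤ 2 ^ Nat.clog 2 t := Nat.le_pow_clog one_lt_two t
  let l : ℕ → V → ℝ := fun i v => if v ∈ S then 0 else if (c v).testBit i then 1 else -1
  refine ⟨fun i => unitIntervalGraph (l i),
    fun i => ⟨isUnitIntervalGraph_unitIntervalGraph _, fun u v huv => ⟨huv.ne, ?_⟩⟩,
    fun u v huv hu hv h => ?_⟩
  · have hl : ∀ w, |l i w| ≤ 1 := fun w => by
      simp only [l]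
      split_ifs <;> norm_num
    rcases hcover u v huv with hS | hS
    · simpa [show l i u = 0 from if_pos hS] using hl v
    · simpa [show l i v = 0 from if_pos hS] using hl u
  · have hcne : c u ≠ c v := fun hcc =>
      huv (hf (G.neighborSet u) ⟨hu, rfl⟩ ⟨hv, h.symm⟩ (by simpa only [c, ← h] using hcc))
    obtain ⟨i, hi, hbit⟩ := Nat.exists_testBit_ne_of_lt_two_pow (hc u hu) (hc v hv) hcne
    refine ⟨⟨i, hi⟩, fun hadj => absurd hadj.2 ?_⟩
    cases hcu : (c u).testBit i <;> cases hcv : (c v).testBit i <;>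
      simp_all [l] <;> norm_num
end
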